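/- Consider an Ising model with zero magnetic field on p spins with maximum degree d and maximum coupling intensity β, fix a node u ∈ V, and let H be the (p−1)×(p−1) matrix with entries H_ij = E[σ_i σ_j] under μ for i, j ≠ u. Then for every Δ_u ∈ ℝ^{p−1}, Δ_uᵀ H Δ_u ≥ (e^{−2βd} / (d+1)) · ‖Δ_u‖₂². -/

import Mathlib

open scoped BigOperators Classical

noncomputable section

/-- The ±1 spin value associated to a Boolean. -/
def spin (b : Bool) : ℝ := if b then 1 else -1

/-- The energy term of the zero-field Ising model with (symmetric, zero-diagonal)
couplings `θ`: the sum over undirected edges of `θ i j * σ_i * σ_j`. -/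
def ham {p : ℕ} (θ : Fin p → Fin p → ℝ) (σ : Fin p → Bool) : ℝ :=
  (1 / 2) * ∑ i, ∑ j, θ i j * spin (σ i) * spin (σ j)

/-- The Gibbs probability `μ(σ) = exp(ham θ σ) / Z`. -/
def gibbs {p : ℕ} (θ : Fin p → Fin p → ℝ) (σ : Fin p → Bool) : ℝ :=
  Real.exp (ham θ σ) / ∑ τ : Fin p → Bool, Real.exp (ham θ τ)

/-- Probability of the event `P` under `n` i.i.d. samples from the Ising model. -/
def probn {p : ℕ} (θ : Fin p → Fin p → ℝ) (n : ℕ)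
    (P : (Fin n → Fin p → Bool) → Prop) : ℝ :=
  ∑ σs : Fin n → Fin p → Bool, if P σs then ∏ k, gibbs θ (σs k) else 0

/-- The Interaction Screening Objective at node `u`. -/
def ISO {p : ℕ} (n : ℕ) (σs : Fin n → Fin p → Bool) (u : Fin p) (θu : Fin p → ℝ) : ℝ :=
  (1 / n : ℝ) *
    ∑ k, Real.exp (-∑ i ∈ Finset.univ.erase u, θu i * spin (σs k u) * spin (σs k i))

/-- The gradient (vector of partial derivatives) of the Interaction Screening Objective. -/
def gradISO {p : ℕ} (n : ℕ) (σs : Fin n → Fin p → Bool) (u : Fin p) (θu : Fin p → ℝ)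
    (l : Fin p) : ℝ :=
  (1 / n : ℝ) *
    ∑ k, (-(spin (σs k u) * spin (σs k l))) *
      Real.exp (-∑ i ∈ Finset.univ.erase u, θu i * spin (σs k u) * spin (σs k i))

/-- ℓ₁-norm of a coupling vector around node `u` (the `u`-entry is excluded). -/
def l1 {p : ℕ} (u : Fin p) (x : Fin p → ℝ) : ℝ := ∑ i ∈ Finset.univ.erase u, |x i|

/-- ℓ₂-norm of a coupling vector around node `u` (the `u`-entry is excluded). -/
def l2 {p : ℕ} (u : Fin p) (x : Fin p → ℝ) : ℝ :=
  Real.sqrt (∑ i ∈ Finset.univ.erase u, x i ^ 2)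

def fl {p : ℕ} (i : Fin p) (σ : Fin p → Bool) : Fin p → Bool := Function.update σ i (!σ i)

lemma fl_same {p : ℕ} (i : Fin p) (σ : Fin p → Bool) : spin (fl i σ i) = - spin (σ i) := by
  cases h : σ i <;> simp [fl, spin, h]

lemma fl_ne {p : ℕ} {i j : Fin p} (h : j ≠ i) (σ : Fin p → Bool) : fl i σ j = σ j := by
  simp [fl, h]

lemma fl_fl {p : ℕ} (i : Fin p) (σ : Fin p → Bool) : fl i (fl i σ) = σ := by
  simp [fl]

lemma spin_sq (b : Bool) : spin b * spin b = 1 := by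
  cases b <;> simp [spin]

def fld {p : ℕ} (θ : Fin p → Fin p → ℝ) (i : Fin p) (σ : Fin p → Bool) : ℝ :=
  ∑ j, θ i j * spin (σ j)

lemma fld_fl {p : ℕ} (θ : Fin p → Fin p → ℝ) {i j : Fin p} (h : θ j i = 0)
    (σ : Fin p → Bool) : fld θ j (fl i σ) = fld θ j σ := by
  unfold fld
  refine Finset.sum_congr rfl fun k _ => ?_
  by_cases hk : k = i
  · subst hk; simp [h]
  · rw [fl_ne hk]

lemma ham_fl {p : ℕ} (θ : Fin p → Fin p → ℝ)
    (hsymm : ∀ i j, θ i j = θ j i) (hdiag : ∀ i, θ i i = 0) (i : Fin p) (σ : Fin p → Bool) :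
    ham θ (fl i σ) = ham θ σ - 2 * (spin (σ i) * fld θ i σ) := by
  have key : ∀ τ : Fin p → Bool, ham θ τ = spin (τ i) * fld θ i τ +
      (1/2) * ∑ k ∈ Finset.univ.erase i, ∑ j ∈ Finset.univ.erase i,
        θ k j * spin (τ k) * spin (τ j) := by
    intro τ
    have h1 : ∀ f : Fin p → ℝ, ∑ k, f k = f i + ∑ k ∈ Finset.univ.erase i, f k := fun f =>
      (Finset.add_sum_erase _ f (Finset.mem_univ i)).symm
    have h2 : fld θ i τ = ∑ k ∈ Finset.univ.erase i, θ i k * spin (τ k) := by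
      unfold fld; rw [h1]; simp [hdiag]
    unfold ham
    rw [h1]
    have h3 : ∀ k, ∑ j, θ k j * spin (τ k) * spin (τ j) = θ k i * spin (τ k) * spin (τ i) +
      ∑ j ∈ Finset.univ.erase i, θ k j * spin (τ k) * spin (τ j) := fun k => h1 _
    simp only [h3, Finset.sum_add_distrib]
    have h4 : ∑ k ∈ Finset.univ.erase i, θ k i * spin (τ k) * spin (τ i)
        = spin (τ i) * fld θ i τ := by
      rw [h2, Finset.mul_sum]
      refine Finset.sum_congr rfl fun k _ => ?_
      rw [hsymm k i]; ring
    have h5 : ∑ j ∈ Finset.univ.erase i, θ i j * spin (τ i) * spin (τ j)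
        = spin (τ i) * fld θ i τ := by
      rw [h2, Finset.mul_sum]
      refine Finset.sum_congr rfl fun k _ => ?_
      ring
    rw [h4, h5, hdiag]; ring
  rw [key (fl i σ), key σ, fld_fl θ (hdiag i), fl_same]
  have : ∑ k ∈ Finset.univ.erase i, ∑ j ∈ Finset.univ.erase i,
        θ k j * spin (fl i σ k) * spin (fl i σ j) = ∑ k ∈ Finset.univ.erase i,
        ∑ j ∈ Finset.univ.erase i, θ k j * spin (σ k) * spin (σ j) := by
    refine Finset.sum_congr rfl fun k hk => Finset.sum_congr rfl fun j hj => ?_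
    rw [fl_ne (Finset.ne_of_mem_erase hk), fl_ne (Finset.ne_of_mem_erase hj)]
  rw [this]; ring

/-- conditional score -/
def sc {p : ℕ} (θ : Fin p → Fin p → ℝ) (i : Fin p) (σ : Fin p → Bool) : ℝ :=
  spin (σ i) - Real.tanh (fld θ i σ)

def ex {p : ℕ} (θ : Fin p → Fin p → ℝ) (f : (Fin p → Bool) → ℝ) : ℝ := ∑ σ, gibbs θ σ * f σ

lemma Zpos {p : ℕ} (θ : Fin p → Fin p → ℝ) : 0 < ∑ τ : Fin p → Bool, Real.exp (ham θ τ) :=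
  Finset.sum_pos (fun _ _ => Real.exp_pos _) Finset.univ_nonempty

lemma gibbs_nonneg {p : ℕ} (θ : Fin p → Fin p → ℝ) (σ : Fin p → Bool) : 0 ≤ gibbs θ σ :=
  div_nonneg (Real.exp_pos _).le (Zpos θ).le

lemma gibbs_sum {p : ℕ} (θ : Fin p → Fin p → ℝ) : ∑ σ, gibbs θ σ = 1 := by
  unfold gibbs
  rw [← Finset.sum_div, div_self (Zpos θ).ne']

lemma ex_mono {p : ℕ} (θ : Fin p → Fin p → ℝ) {f g : (Fin p → Bool) → ℝ} (h : ∀ σ, f σ ≤ g σ) :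
    ex θ f ≤ ex θ g :=
  Finset.sum_le_sum fun σ _ => mul_le_mul_of_nonneg_left (h σ) (gibbs_nonneg θ σ)

lemma ex_const {p : ℕ} (θ : Fin p → Fin p → ℝ) (c : ℝ) : ex θ (fun _ => c) = c := by
  unfold ex; rw [← Finset.sum_mul, gibbs_sum, one_mul]

lemma ex_add {p : ℕ} (θ : Fin p → Fin p → ℝ) (f g : (Fin p → Bool) → ℝ) :
    ex θ (fun σ => f σ + g σ) = ex θ f + ex θ g := by
  unfold ex; rw [← Finset.sum_add_distrib]; exact Finset.sum_congr rfl fun _ _ => by ring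

lemma ex_smul {p : ℕ} (θ : Fin p → Fin p → ℝ) (c : ℝ) (f : (Fin p → Bool) → ℝ) :
    ex θ (fun σ => c * f σ) = c * ex θ f := by
  unfold ex; rw [Finset.mul_sum]; exact Finset.sum_congr rfl fun _ _ => by ring

lemma ex_sum2 {p : ℕ} (θ : Fin p → Fin p → ℝ) (S : Finset (Fin p)) (Δ : Fin p → ℝ)
    (a b : Fin p → (Fin p → Bool) → ℝ) :
    ex θ (fun σ => (∑ i ∈ S, Δ i * a i σ) * (∑ j ∈ S, Δ j * b j σ)) =
      ∑ i ∈ S, ∑ j ∈ S, Δ i * ex θ (fun σ => a i σ * b j σ) * Δ j := by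
  unfold ex
  simp only [Finset.sum_mul_sum]
  simp only [Finset.mul_sum, Finset.sum_mul]
  rw [Finset.sum_comm]
  refine Finset.sum_congr rfl fun i _ => ?_
  rw [Finset.sum_comm]
  refine Finset.sum_congr rfl fun j _ => Finset.sum_congr rfl fun σ _ => ?_
  ring

lemma tanh_id (h : ℝ) : Real.exp h * (1 - Real.tanh h) = Real.exp (-h) * (1 + Real.tanh h) := by
  have hc := (Real.cosh_pos h).ne'
  rw [Real.tanh_eq_sinh_div_cosh]
  field_simp
  rw [Real.cosh_sub_sinh, add_comm, Real.sinh_add_cosh]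
  ring

lemma sech_bound (h B : ℝ) (hB : |h| ≤ B) : Real.exp (-(2 * B)) ≤ 1 - Real.tanh h ^ 2 := by
  have hc := Real.cosh_pos h
  have h1 : 1 - Real.tanh h ^ 2 = (Real.cosh h ^ 2)⁻¹ := by
    rw [Real.tanh_eq_sinh_div_cosh]
    field_simp
    linarith [Real.cosh_sq h]
  have h2 : Real.cosh h ≤ Real.exp B := by
    rw [Real.cosh_eq]
    have := Real.exp_le_exp.2 ((le_abs_self h).trans hB)
    have := Real.exp_le_exp.2 ((neg_le_abs h).trans hB)
    linarith
  rw [h1, Real.exp_neg]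
  have h3 : Real.exp (2 * B) = Real.exp B ^ 2 := by rw [← Real.exp_nat_mul]; norm_num
  rw [h3]
  gcongr

lemma ex_sc {p : ℕ} (θ : Fin p → Fin p → ℝ)
    (hsymm : ∀ i j, θ i j = θ j i) (hdiag : ∀ i, θ i i = 0) (i : Fin p)
    (F : (Fin p → Bool) → ℝ) (hF : ∀ σ, F (fl i σ) = F σ) :
    ex θ (fun σ => sc θ i σ * F σ) = 0 := by
  have e : ex θ (fun σ => sc θ i σ * F σ) =
      ∑ σ, gibbs θ (fl i σ) * (sc θ i (fl i σ) * F (fl i σ)) := by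
    unfold ex
    exact (Equiv.sum_comp (Function.Involutive.toPerm (fl i) (fl_fl i))
      (fun σ => gibbs θ σ * (sc θ i σ * F σ))).symm
  have e2 : ∀ σ, gibbs θ (fl i σ) * (sc θ i (fl i σ) * F (fl i σ)) =
      - (gibbs θ σ * (sc θ i σ * F σ)) := by
    intro σ
    have hk : Real.exp (ham θ (fl i σ)) * sc θ i (fl i σ) =
        - (Real.exp (ham θ σ) * sc θ i σ) := by
      unfold sc
      rw [fl_same, fld_fl θ (hdiag i), ham_fl θ hsymm hdiag]
      set h := fld θ i σ
      have ht := tanh_id h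
      cases hs : σ i
      · have a1 : Real.exp (ham θ σ - 2 * (spin false * h)) =
          Real.exp (ham θ σ + h) * Real.exp h := by
          rw [← Real.exp_add]; congr 1; simp [spin]; ring
        have a2 : Real.exp (ham θ σ) = Real.exp (ham θ σ + h) * Real.exp (-h) := by
          rw [← Real.exp_add]; congr 1; ring
        rw [a1, a2]; simp only [spin]; simp
        linear_combination Real.exp (ham θ σ + h) * ht
      · have a1 : Real.exp (ham θ σ - 2 * (spin true * h)) =
          Real.exp (ham θ σ - h) * Real.exp (-h) := by
          rw [← Real.exp_add]; congr 1; simp [spin]; ring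
        have a2 : Real.exp (ham θ σ) = Real.exp (ham θ σ - h) * Real.exp h := by
          rw [← Real.exp_add]; congr 1; ring
        rw [a1, a2]; simp only [spin]; simp
        linear_combination Real.exp (ham θ σ - h) * ht
    rw [hF]
    unfold gibbs
    linear_combination (F σ / ∑ τ : Fin p → Bool, Real.exp (ham θ τ)) * hk
  rw [Finset.sum_congr rfl fun σ _ => e2 σ, Finset.sum_neg_distrib] at e
  have : ex θ (fun σ => sc θ i σ * F σ) = ∑ σ, gibbs θ σ * (sc θ i σ * F σ) := rfl
  linarith

lemma main_bound {p : ℕ} (d : ℕ) (β : ℝ) (θ : Fin p → Fin p → ℝ)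
    (hsymm : ∀ i j, θ i j = θ j i) (hdiag : ∀ i, θ i i = 0)
    (hdeg : ∀ i, (Finset.univ.filter fun j => θ i j ≠ 0).card ≤ d)
    (hβ : ∀ i j, |θ i j| ≤ β) (S : Finset (Fin p)) (Δ : Fin p → ℝ) :
    Real.exp (-(2 * β * d)) / ((d : ℝ) + 1) * ∑ i ∈ S, Δ i ^ 2 ≤
    ∑ i ∈ S, ∑ j ∈ S, Δ i * ex θ (fun σ => spin (σ i) * spin (σ j)) * Δ j := by
  set v : Fin p → ℝ := fun i => ex θ (fun σ => sc θ i σ * sc θ i σ) with hv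
  have hst : ∀ i, ex θ (fun σ => sc θ i σ * Real.tanh (fld θ i σ)) = 0 := fun i =>
    ex_sc θ hsymm hdiag i _ fun σ => by rw [fld_fl θ (hdiag i)]
  have hfld : ∀ i σ, |fld θ i σ| ≤ β * d := by
    intro i σ
    have hβ0 : 0 ≤ β := (abs_nonneg _).trans (hβ i i)
    unfold fld
    have : ∑ j, θ i j * spin (σ j) =
        ∑ j ∈ Finset.univ.filter (fun j => θ i j ≠ 0), θ i j * spin (σ j) := by
      symm
      apply Finset.sum_subset (Finset.filter_subset _ _)
      intro j _ hj
      have : θ i j = 0 := by simpa using hj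
      simp [this]
    rw [this]
    refine (Finset.abs_sum_le_sum_abs _ _).trans ?_
    have h1 : ∀ j ∈ Finset.univ.filter (fun j => θ i j ≠ 0), |θ i j * spin (σ j)| ≤ β := by
      intro j _
      have : |spin (σ j)| = 1 := by cases σ j <;> simp [spin]
      rw [abs_mul, this, mul_one]; exact hβ i j
    refine (Finset.sum_le_card_nsmul _ _ _ h1).trans ?_
    rw [nsmul_eq_mul, mul_comm]
    exact mul_le_mul_of_nonneg_left (by exact_mod_cast hdeg i) hβ0
  have hvlow : ∀ i, Real.exp (-(2 * β * d)) ≤ v i := by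
    intro i
    have : v i = ex θ (fun σ => 1 - Real.tanh (fld θ i σ) ^ 2) := by
      have h1 : (fun σ => sc θ i σ * sc θ i σ) = fun σ => (1 - Real.tanh (fld θ i σ) ^ 2) +
          (-2) * (sc θ i σ * Real.tanh (fld θ i σ)) := by
        funext σ
        unfold sc
        linear_combination spin_sq (σ i)
      rw [hv]; simp only
      rw [h1, ex_add, ex_smul, hst]; ring
    rw [this, ← ex_const θ (Real.exp (-(2 * β * d)))]
    refine ex_mono θ fun σ => ?_
    rw [mul_assoc]
    exact sech_bound _ _ (hfld i σ)
  have hvpos : ∀ i, 0 ≤ v i := fun i => (Real.exp_pos _).le.trans (hvlow i)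
  have hxs : ∀ i j, ex θ (fun σ => spin (σ i) * sc θ j σ) = if i = j then v i else 0 := by
    intro i j
    split_ifs with h
    · subst h
      have h1 : (fun σ => spin (σ i) * sc θ i σ) = fun σ => sc θ i σ * sc θ i σ +
          sc θ i σ * Real.tanh (fld θ i σ) := by
        funext σ; unfold sc; ring
      rw [h1, ex_add, hst, add_zero]
    · have := ex_sc θ hsymm hdiag j (fun σ => spin (σ i)) fun σ => by simp only [fl_ne h]
      rw [← this]; congr 1; funext σ; ring
  set a : Fin p → Fin p → ℝ := fun i j => if i = j ∨ θ i j ≠ 0 then 1 else 0 with ha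
  have hss : ∀ i j, Δ i * ex θ (fun σ => sc θ i σ * sc θ j σ) * Δ j ≤
      a i j * ((Δ i ^ 2 * v i + Δ j ^ 2 * v j) / 2) := by
    intro i j
    by_cases h : i = j ∨ θ i j ≠ 0
    · simp only [ha, if_pos h, one_mul]
      have h0 : 0 ≤ ex θ (fun σ => (Δ i * sc θ i σ - Δ j * sc θ j σ) ^ 2) := by
        rw [← ex_const θ 0]; exact ex_mono θ fun σ => sq_nonneg _
      have h1 : (fun σ => (Δ i * sc θ i σ - Δ j * sc θ j σ) ^ 2) = fun σ =>
          (Δ i ^ 2 * (sc θ i σ * sc θ i σ) + Δ j ^ 2 * (sc θ j σ * sc θ j σ)) +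
          (-2 * Δ i * Δ j) * (sc θ i σ * sc θ j σ) := by
        funext σ; ring
      rw [h1, ex_add, ex_add, ex_smul, ex_smul, ex_smul] at h0
      simp only [hv]
      linarith
    · simp only [ha, if_neg h, zero_mul]
      push Not at h
      have := ex_sc θ hsymm hdiag i (fun σ => sc θ j σ) fun σ => by
        unfold sc
        rw [fl_ne (Ne.symm h.1), fld_fl θ (by rw [hsymm]; exact h.2)]
      rw [this]; simp
  have hasum : ∀ i, ∑ j ∈ S, a i j ≤ (d : ℝ) + 1 := by
    intro i
    have h1 : ∑ j ∈ S, a i j ≤ ∑ j, ((if i = j then (1:ℝ) else 0) + if θ i j ≠ 0 then 1 else 0) := by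
      refine (Finset.sum_le_sum_of_subset_of_nonneg (Finset.subset_univ S) ?_).trans
        (Finset.sum_le_sum ?_)
      · intro j _ _; simp only [ha]; split_ifs <;> norm_num
      · intro j _
        simp only [ha]
        by_cases h1 : i = j <;> by_cases h2 : θ i j = 0 <;> simp [h1, h2] <;> split_ifs <;> norm_num
    refine h1.trans ?_
    rw [Finset.sum_add_distrib, Finset.sum_ite_eq, Finset.sum_boole]
    simp only [Finset.mem_univ, if_true]
    have : (((Finset.univ.filter fun j => θ i j ≠ 0).card : ℕ) : ℝ) ≤ d := by
      exact_mod_cast hdeg i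
    linarith
  have hasymm : ∀ i j, a i j = a j i := by
    intro i j; simp only [ha, hsymm i j, eq_comm (a := i)]
  set Q := ∑ i ∈ S, Δ i ^ 2 * v i with hQ
  have hG : ∑ i ∈ S, ∑ j ∈ S, Δ i * ex θ (fun σ => sc θ i σ * sc θ j σ) * Δ j ≤ (d + 1) * Q := by
    refine (Finset.sum_le_sum fun i _ => Finset.sum_le_sum fun j _ => hss i j).trans ?_
    have e1 : ∑ i ∈ S, ∑ j ∈ S, a i j * (Δ i ^ 2 * v i) ≤ (d + 1) * Q := by
      rw [hQ, Finset.mul_sum]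
      refine Finset.sum_le_sum fun i _ => ?_
      rw [← Finset.sum_mul]
      exact mul_le_mul_of_nonneg_right (hasum i) (mul_nonneg (sq_nonneg _) (hvpos i))
    have e2 : ∑ i ∈ S, ∑ j ∈ S, a i j * (Δ j ^ 2 * v j) =
        ∑ i ∈ S, ∑ j ∈ S, a i j * (Δ i ^ 2 * v i) := by
      rw [Finset.sum_comm]
      exact Finset.sum_congr rfl fun i _ => Finset.sum_congr rfl fun j _ => by rw [hasymm]
    have e3 : ∑ i ∈ S, ∑ j ∈ S, a i j * ((Δ i ^ 2 * v i + Δ j ^ 2 * v j) / 2) =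
        (∑ i ∈ S, ∑ j ∈ S, a i j * (Δ i ^ 2 * v i) +
          ∑ i ∈ S, ∑ j ∈ S, a i j * (Δ j ^ 2 * v j)) / 2 := by
      simp only [← Finset.sum_add_distrib, Finset.sum_div]
      exact Finset.sum_congr rfl fun i _ => Finset.sum_congr rfl fun j _ => by ring
    rw [e3, e2]; linarith
  have hC : ∑ i ∈ S, ∑ j ∈ S, Δ i * ex θ (fun σ => spin (σ i) * sc θ j σ) * Δ j = Q := by
    rw [hQ]
    refine Finset.sum_congr rfl fun i hi => ?_
    simp only [hxs]
    rw [Finset.sum_eq_single_of_mem i hi]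
    · simp; ring
    · intro j _ hj; simp [Ne.symm hj]
  rw [← ex_sum2 θ S Δ (fun i σ => spin (σ i)) (fun i σ => sc θ i σ)] at hC
  rw [← ex_sum2 θ S Δ (fun i σ => sc θ i σ) (fun i σ => sc θ i σ)] at hG
  rw [← ex_sum2 θ S Δ (fun i σ => spin (σ i)) (fun i σ => spin (σ i))]
  set t : ℝ := ((d : ℝ) + 1)⁻¹ with ht
  have htd : t * ((d : ℝ) + 1) = 1 := inv_mul_cancel₀ (by positivity)
  have htpos : 0 ≤ t := by positivity
  set X : (Fin p → Bool) → ℝ := fun σ => ∑ i ∈ S, Δ i * spin (σ i) with hX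
  set g : (Fin p → Bool) → ℝ := fun σ => ∑ i ∈ S, Δ i * sc θ i σ with hg
  change ex θ (fun σ => X σ * g σ) = Q at hC
  change ex θ (fun σ => g σ * g σ) ≤ _ at hG
  change _ ≤ ex θ (fun σ => X σ * X σ)
  have h0 : 0 ≤ ex θ (fun σ => (X σ - t * g σ) ^ 2) := by
    rw [← ex_const θ 0]; exact ex_mono θ fun σ => sq_nonneg _
  have h1 : (fun σ => (X σ - t * g σ) ^ 2) = fun σ =>
      (X σ * X σ + (-2 * t) * (X σ * g σ)) + t ^ 2 * (g σ * g σ) := by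
    funext σ; ring
  rw [h1, ex_add, ex_add, ex_smul, ex_smul, hC] at h0
  have h2 : t ^ 2 * ex θ (fun σ => g σ * g σ) ≤ t * Q := by
    calc _ ≤ t ^ 2 * ((d + 1) * Q) := mul_le_mul_of_nonneg_left hG (sq_nonneg t)
      _ = t * Q := by linear_combination t * Q * htd
  have h3 : Real.exp (-(2 * β * d)) * ∑ i ∈ S, Δ i ^ 2 ≤ Q := by
    rw [hQ, Finset.mul_sum]
    refine Finset.sum_le_sum fun i _ => ?_
    rw [mul_comm]
    exact mul_le_mul_of_nonneg_left (hvlow i) (sq_nonneg _)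
  have h4 := mul_le_mul_of_nonneg_left h3 htpos
  have h5 : Real.exp (-(2 * β * d)) / ((d : ℝ) + 1) * ∑ i ∈ S, Δ i ^ 2 =
      t * (Real.exp (-(2 * β * d)) * ∑ i ∈ S, Δ i ^ 2) := by
    rw [ht, div_eq_mul_inv]; ring
  rw [h5]; linarith

/-- **Lemma 7 (the covariance quadratic form is non-degenerate).**
For a zero-field Ising model on `p` spins with maximum degree `d` and maximum coupling
intensity `β`, a node `u`, and the covariance matrix `H_ij = E[σ_i σ_j]` (`i, j ≠ u`),
every `Δ_u ∈ ℝ^{p-1}` satisfies `Δ_uᵀ H Δ_u ≥ (e^{-2βd}/(d+1)) ‖Δ_u‖₂²`. -/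
theorem stmt11 {p : ℕ} (d : ℕ) (β : ℝ) (θ : Fin p → Fin p → ℝ)
    (hsymm : ∀ i j, θ i j = θ j i) (hdiag : ∀ i, θ i i = 0)
    (hdeg : ∀ i, (Finset.univ.filter fun j => θ i j ≠ 0).card ≤ d)
    (hβ : ∀ i j, |θ i j| ≤ β)
    (u : Fin p) (Δ : Fin p → ℝ) :
    ∑ i ∈ Finset.univ.erase u, ∑ j ∈ Finset.univ.erase u,
        Δ i * (∑ σ : Fin p → Bool, gibbs θ σ * (spin (σ i) * spin (σ j))) * Δ j ≥
      Real.exp (-(2 * β * d)) / ((d : ℝ) + 1) * ∑ i ∈ Finset.univ.erase u, Δ i ^ 2 := by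
  exact main_bound d β θ hsymm hdiag hdeg hβ (Finset.univ.erase u) Δ
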